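/- Diffusion maps pointwise generator for general normalization parameter α (flat Euclidean version): let q be a C^∞ probability density on ℝ^d with q(x) > 0 for all x, all partial derivatives of q bounded, and q(y) ≥ C e^{−c‖y‖²} for some constants C, c > 0. Put q_ε := D_ε q and, for α ∈ [0,1] and f ∈ C_c^∞(ℝ^d), define P_{ε,α} f(x) := [∫ k_ε(x,y) q_ε(y)^{−α} f(y) q(y) dy] / [∫ k_ε(x,y) q_ε(y)^{−α} q(y) dy]. Then for every x ∈ ℝ^d, lim_{ε→0+} ε^{−1} (P_{ε,α} f(x) − f(x)) = Δ(f q^{1−α})(x) / (4 q^{1−α}(x)) − [Δ(q^{1−α})(x) / (4 q^{1−α}(x))] f(x). -/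

import Mathlib

open MeasureTheory Filter
open scoped Topology

/-- The Laplacian on `ℝ^d`: sum of the second derivatives in the coordinate directions. -/
noncomputable def laplacian {d : ℕ} (f : EuclideanSpace ℝ (Fin d) → ℝ)
    (x : EuclideanSpace ℝ (Fin d)) : ℝ :=
  ∑ i : Fin d, iteratedFDeriv ℝ 2 f x
    ![EuclideanSpace.single i (1 : ℝ), EuclideanSpace.single i (1 : ℝ)]

section Gaussian

variable {d : ℕ}

/-- The Gaussian probability density on `ℝ^d` with covariance `1/2` times the identity. -/
noncomputable def gaussDensity (z : EuclideanSpace ℝ (Fin d)) : ℝ :=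
  Real.pi ^ (-(d : ℝ) / 2) * Real.exp (-‖z‖ ^ 2)

/-- A Gaussian function of larger variance, with polynomial factor, used as a dominating function. -/
noncomputable def gaussMajorant (z : EuclideanSpace ℝ (Fin d)) : ℝ :=
  gaussDensity z * ((1 + ‖z‖) ^ 2 * Real.exp (‖z‖ ^ 2 / 4))

theorem gaussDensity_pos (z : EuclideanSpace ℝ (Fin d)) : 0 < gaussDensity z := by
  unfold gaussDensity
  positivity

@[fun_prop]
theorem continuous_gaussDensity :
    Continuous (gaussDensity : EuclideanSpace ℝ (Fin d) → ℝ) := by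
  unfold gaussDensity
  fun_prop

theorem integrable_exp_neg_mul_norm_sq {b : ℝ} (hb : 0 < b) :
    Integrable (fun z : EuclideanSpace ℝ (Fin d) => Real.exp (-b * ‖z‖ ^ 2)) := by
  have h := (GaussianFourier.integrable_cexp_neg_mul_sq_norm_add (b := (b : ℂ)) (by simpa using hb)
    0 (0 : EuclideanSpace ℝ (Fin d))).re
  refine h.congr (Eventually.of_forall fun z => ?_)
  have : (-(b : ℂ) * (‖z‖ : ℂ) ^ 2 + 0 * ((inner ℝ (0 : EuclideanSpace ℝ (Fin d)) z : ℝ) : ℂ))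
      = ((-b * ‖z‖ ^ 2 : ℝ) : ℂ) := by
    push_cast
    ring
  simp only [this, ← Complex.ofReal_exp]
  exact Complex.ofReal_re _

theorem one_add_sq_le_exp (r : ℝ) : (1 + r) ^ 2 ≤ 8 * Real.exp (r ^ 2 / 4) := by
  have := Real.add_one_le_exp (r ^ 2 / 4)
  nlinarith [sq_nonneg (r - 1)]

theorem integrable_gaussMajorant :
    Integrable (gaussMajorant : EuclideanSpace ℝ (Fin d) → ℝ) := by
  have h := ((integrable_exp_neg_mul_norm_sq (d := d) (b := 1 / 2) (by norm_num)).const_mul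
    (8 * Real.pi ^ (-(d : ℝ) / 2)))
  refine h.mono' ?_ (Eventually.of_forall fun z => ?_)
  · unfold gaussMajorant
    exact Continuous.aestronglyMeasurable (by fun_prop)
  · unfold gaussMajorant gaussDensity
    rw [Real.norm_of_nonneg (by positivity)]
    have h1 := one_add_sq_le_exp ‖z‖
    have h2 : Real.exp (-(1 / 2) * ‖z‖ ^ 2) =
        Real.exp (-‖z‖ ^ 2) * (Real.exp (‖z‖ ^ 2 / 4) * Real.exp (‖z‖ ^ 2 / 4)) := by
      rw [← Real.exp_add, ← Real.exp_add]
      ring_nf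
    rw [h2]
    calc _ = Real.pi ^ (-(d : ℝ) / 2) * Real.exp (-‖z‖ ^ 2) * Real.exp (‖z‖ ^ 2 / 4)
          * (1 + ‖z‖) ^ 2 := by ring
      _ ≤ Real.pi ^ (-(d : ℝ) / 2) * Real.exp (-‖z‖ ^ 2) * Real.exp (‖z‖ ^ 2 / 4)
          * (8 * Real.exp (‖z‖ ^ 2 / 4)) := by gcongr
      _ = _ := by ring

theorem gaussDensity_mul_norm_le {K t : ℝ} {z : EuclideanSpace ℝ (Fin d)}
    (h : |t| ≤ K * ((1 + ‖z‖) ^ 2 * Real.exp (‖z‖ ^ 2 / 4))) :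
    ‖gaussDensity z * t‖ ≤ K * gaussMajorant z := by
  have h0 := gaussDensity_pos z
  rw [norm_mul, Real.norm_of_nonneg h0.le, Real.norm_eq_abs, gaussMajorant]
  calc _ ≤ gaussDensity z * (K * ((1 + ‖z‖) ^ 2 * Real.exp (‖z‖ ^ 2 / 4))) := by gcongr
    _ = _ := by ring

theorem integrable_gaussDensity_mul {F : EuclideanSpace ℝ (Fin d) → ℝ}
    (hF : AEStronglyMeasurable F) {K : ℝ}
    (h : ∀ z, |F z| ≤ K * ((1 + ‖z‖) ^ 2 * Real.exp (‖z‖ ^ 2 / 4))) :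
    Integrable (fun z => gaussDensity z * F z) :=
  (integrable_gaussMajorant.const_mul K).mono'
    (continuous_gaussDensity.aestronglyMeasurable.mul hF)
    (Eventually.of_forall fun z => gaussDensity_mul_norm_le (h z))

theorem tendsto_integral_gaussDensity_mul {l : Filter ℝ} [l.IsCountablyGenerated]
    {F : ℝ → EuclideanSpace ℝ (Fin d) → ℝ} {F0 : EuclideanSpace ℝ (Fin d) → ℝ} {K : ℝ}
    (hF : ∀ᶠ s in l, AEStronglyMeasurable (F s))
    (h : ∀ᶠ s in l, ∀ z, |F s z| ≤ K * ((1 + ‖z‖) ^ 2 * Real.exp (‖z‖ ^ 2 / 4)))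
    (hlim : ∀ z, Tendsto (fun s => F s z) l (𝓝 (F0 z))) :
    Tendsto (fun s => ∫ z, gaussDensity z * F s z) l (𝓝 (∫ z, gaussDensity z * F0 z)) := by
  refine tendsto_integral_filter_of_dominated_convergence (fun z => K * gaussMajorant z) ?_ ?_
    (integrable_gaussMajorant.const_mul K)
    (Eventually.of_forall fun z => (hlim z).const_mul _)
  · filter_upwards [hF] with s hs
    exact continuous_gaussDensity.aestronglyMeasurable.mul hs
  · filter_upwards [h] with s hs
    exact Eventually.of_forall fun z => gaussDensity_mul_norm_le (hs z)

theorem le_one_add_sq_mul_exp (z : EuclideanSpace ℝ (Fin d)) :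
    (1 + ‖z‖) ^ 2 ≤ (1 + ‖z‖) ^ 2 * Real.exp (‖z‖ ^ 2 / 4) :=
  le_mul_of_one_le_right (by positivity) (Real.one_le_exp (by positivity))

theorem integral_gaussDensity : ∫ z : EuclideanSpace ℝ (Fin d), gaussDensity z = 1 := by
  have h := GaussianFourier.integral_rexp_neg_mul_sq_norm (V := EuclideanSpace ℝ (Fin d)) one_pos
  simp only [neg_mul, one_mul, div_one, finrank_euclideanSpace, Fintype.card_fin] at h
  unfold gaussDensity
  rw [integral_const_mul, h, ← Real.rpow_add Real.pi_pos]
  simp [neg_div]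

theorem gaussDensity_neg (z : EuclideanSpace ℝ (Fin d)) : gaussDensity (-z) = gaussDensity z := by
  simp [gaussDensity]

theorem integrable_gaussDensity : Integrable (gaussDensity : EuclideanSpace ℝ (Fin d) → ℝ) := by
  have := integrable_gaussDensity_mul (d := d) (F := fun _ => 1) (K := 1)
    aestronglyMeasurable_const (fun z => by
      have := le_one_add_sq_mul_exp z
      rw [abs_one]
      nlinarith [norm_nonneg z])
  simpa using this

theorem integral_gaussDensity_mul_clm (L : EuclideanSpace ℝ (Fin d) →L[ℝ] ℝ) :
    ∫ z, gaussDensity z * L z = 0 := by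
  have h := integral_neg_eq_self (fun z : EuclideanSpace ℝ (Fin d) => gaussDensity z * L z) volume
  simp only [gaussDensity_neg, map_neg, mul_neg, integral_neg] at h
  linarith

theorem integrable_gaussDensity_mul_clm (L : EuclideanSpace ℝ (Fin d) →L[ℝ] ℝ) :
    Integrable (fun z => gaussDensity z * L z) := by
  refine integrable_gaussDensity_mul (K := ‖L‖) L.continuous.aestronglyMeasurable fun z => ?_
  calc |L z| ≤ ‖L‖ * ‖z‖ := L.le_opNorm z
    _ ≤ ‖L‖ * ((1 + ‖z‖) ^ 2 * Real.exp (‖z‖ ^ 2 / 4)) := by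
      gcongr
      exact le_trans (by nlinarith [norm_nonneg z]) (le_one_add_sq_mul_exp z)

theorem integrable_gaussDensity_mul_clm_mul_clm (L M : EuclideanSpace ℝ (Fin d) →L[ℝ] ℝ) :
    Integrable (fun z => gaussDensity z * (L z * M z)) := by
  refine integrable_gaussDensity_mul (K := ‖L‖ * ‖M‖)
    (L.continuous.mul M.continuous).aestronglyMeasurable fun z => ?_
  calc |L z * M z| = |L z| * |M z| := abs_mul _ _
    _ ≤ (‖L‖ * ‖z‖) * (‖M‖ * ‖z‖) := by
      gcongr
      · exact L.le_opNorm z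
      · exact M.le_opNorm z
    _ = ‖L‖ * ‖M‖ * ‖z‖ ^ 2 := by ring
    _ ≤ ‖L‖ * ‖M‖ * ((1 + ‖z‖) ^ 2 * Real.exp (‖z‖ ^ 2 / 4)) := by
      gcongr
      exact le_trans (by nlinarith [norm_nonneg z]) (le_one_add_sq_mul_exp z)

theorem hasFDerivAt_gaussDensity (z : EuclideanSpace ℝ (Fin d)) :
    HasFDerivAt gaussDensity ((-2 * gaussDensity z) • innerSL ℝ z) z := by
  have h := ((((hasStrictFDerivAt_norm_sq z).hasFDerivAt).neg).exp).const_mul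
    (Real.pi ^ (-(d : ℝ) / 2))
  refine h.congr_fderiv ?_
  ext v
  simp [gaussDensity]
  ring

theorem integral_gaussDensity_mul_clm_mul_inner (L : EuclideanSpace ℝ (Fin d) →L[ℝ] ℝ)
    (v : EuclideanSpace ℝ (Fin d)) :
    ∫ z, gaussDensity z * (L z * inner ℝ v z) = L v / 2 := by
  have hder : ∀ z : EuclideanSpace ℝ (Fin d),
      fderiv ℝ gaussDensity z v = -2 * gaussDensity z * inner ℝ v z := fun z => by
    rw [(hasFDerivAt_gaussDensity z).fderiv]
    simp [real_inner_comm]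
  have hint := integrable_gaussDensity_mul_clm_mul_clm L (innerSL ℝ v)
  have key := integral_mul_fderiv_eq_neg_fderiv_mul_of_integrable (μ := volume) (f := L)
    (g := gaussDensity) (v := v) ?_ ?_ ?_ (fun z _ => L.differentiableAt)
    (fun z _ => (hasFDerivAt_gaussDensity z).differentiableAt)
  · simp only [hder, ContinuousLinearMap.fderiv, integral_const_mul, integral_gaussDensity] at key
    have h2 : ∫ z, L z * (-2 * gaussDensity z * inner ℝ v z)
        = -2 * ∫ z, gaussDensity z * (L z * inner ℝ v z) := by
      rw [← integral_const_mul]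
      congr 1
      ext z
      ring
    rw [h2] at key
    linarith
  · simpa using integrable_gaussDensity.const_mul (L v)
  · refine (hint.const_mul (-2)).congr (Eventually.of_forall fun z => ?_)
    simp only [hder, innerSL_apply_apply]
    ring
  · simpa [mul_comm] using integrable_gaussDensity_mul_clm L

theorem integral_gaussDensity_mul_bilin
    (B : EuclideanSpace ℝ (Fin d) →L[ℝ] EuclideanSpace ℝ (Fin d) →L[ℝ] ℝ) :
    Integrable (fun z => gaussDensity z * B z z) ∧
    ∫ z, gaussDensity z * B z z =
      (∑ i, B (EuclideanSpace.single i 1) (EuclideanSpace.single i 1)) / 2 := by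
  have hB : ∀ z, gaussDensity z * B z z = ∑ i, gaussDensity z *
      (B (EuclideanSpace.single i 1) z * inner ℝ (EuclideanSpace.single i 1) z) := fun z => by
    have hz : B z = ∑ i, (z i) • B (EuclideanSpace.single i (1 : ℝ)) := by
      conv_lhs => rw [← (EuclideanSpace.basisFun (Fin d) ℝ).sum_repr z, map_sum]
      simp
    rw [← Finset.mul_sum, hz, sum_apply]
    congr 1
    refine Finset.sum_congr rfl fun i _ => ?_
    rw [EuclideanSpace.inner_single_left]
    simp [mul_comm]
  simp only [hB]
  have hi : ∀ i ∈ Finset.univ, Integrable fun z => gaussDensity z *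
      (B (EuclideanSpace.single i 1) z * inner ℝ (EuclideanSpace.single i (1 : ℝ)) z) :=
    fun i _ => integrable_gaussDensity_mul_clm_mul_clm _ (innerSL ℝ (EuclideanSpace.single i 1))
  refine ⟨integrable_finsetSum _ hi, ?_⟩
  rw [integral_finsetSum _ hi, Finset.sum_div]
  exact Finset.sum_congr rfl fun i _ => integral_gaussDensity_mul_clm_mul_inner _ _

theorem integral_exp_neg_norm_sub_sq_div {s : ℝ} (hs : 0 < s) (x : EuclideanSpace ℝ (Fin d))
    (G : EuclideanSpace ℝ (Fin d) → ℝ) :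
    ∫ y, Real.pi ^ (-(d : ℝ) / 2) * Real.exp (-‖x - y‖ ^ 2 / s ^ 2) * G y =
      s ^ d * ∫ z, gaussDensity z * G (x + s • z) := by
  have h1 := integral_add_left_eq_self (μ := (volume : Measure (EuclideanSpace ℝ (Fin d))))
    (fun y => Real.pi ^ (-(d : ℝ) / 2) * Real.exp (-‖x - y‖ ^ 2 / s ^ 2) * G y) x
  have h2 := Measure.integral_comp_smul_of_nonneg (volume : Measure (EuclideanSpace ℝ (Fin d)))
    (fun y => Real.pi ^ (-(d : ℝ) / 2) * Real.exp (-‖x - (x + y)‖ ^ 2 / s ^ 2) * G (x + y)) s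
    (hR := hs.le)
  rw [← h1]
  have h3 : ∀ z : EuclideanSpace ℝ (Fin d), Real.pi ^ (-(d : ℝ) / 2) *
      Real.exp (-‖x - (x + s • z)‖ ^ 2 / s ^ 2) * G (x + s • z) =
      gaussDensity z * G (x + s • z) := fun z => by
    rw [gaussDensity, sub_add_cancel_left, norm_neg, norm_smul, Real.norm_of_nonneg hs.le]
    congr 3
    field_simp
  simp only [h3, finrank_euclideanSpace, Fintype.card_fin, smul_eq_mul] at h2
  rw [h2, ← mul_assoc, mul_inv_cancel₀ (by positivity), one_mul]

end Gaussian

section Taylor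

variable {E : Type*} [NormedAddCommGroup E] [NormedSpace ℝ E] {g : E → ℝ} {C : ℝ}

theorem norm_sub_le_of_norm_iteratedFDeriv_one_le (hg : ContDiff ℝ 1 g)
    (hC : ∀ x, ‖iteratedFDeriv ℝ 1 g x‖ ≤ C) (x y : E) : |g y - g x| ≤ C * ‖y - x‖ :=
  convex_univ.norm_image_sub_le_of_norm_fderiv_le (𝕜 := ℝ)
    (fun z _ => hg.differentiable one_ne_zero z)
    (fun z _ => by simpa [norm_iteratedFDeriv_one] using hC z) (Set.mem_univ x) (Set.mem_univ y)

theorem norm_sub_fderiv_le_of_norm_iteratedFDeriv_two_le (hg : ContDiff ℝ 2 g)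
    (hC : ∀ x, ‖iteratedFDeriv ℝ 2 g x‖ ≤ C) (x w : E) :
    |g (x + w) - g x - fderiv ℝ g x w| ≤ C * ‖w‖ ^ 2 := by
  have hC0 : 0 ≤ C := (norm_nonneg _).trans (hC x)
  have hlip : ∀ y, ‖fderiv ℝ g y - fderiv ℝ g x‖ ≤ C * ‖y - x‖ := fun y =>
    convex_univ.norm_image_sub_le_of_norm_fderiv_le (𝕜 := ℝ)
      (fun z _ => (hg.fderiv_right (m := 1) (by norm_num)).differentiable one_ne_zero z)
      (fun z _ => by
        have h := hC z
        rwa [← norm_iteratedFDeriv_fderiv (n := 1), norm_iteratedFDeriv_one] at h)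
      (Set.mem_univ x) (Set.mem_univ y)
  have h := (convex_closedBall x ‖w‖).norm_image_sub_le_of_norm_fderiv_le' (𝕜 := ℝ) (f := g)
    (φ := fderiv ℝ g x) (C := C * ‖w‖) (x := x) (y := x + w)
    (fun z _ => hg.differentiable two_ne_zero z)
    (fun z hz => (hlip z).trans (by
      gcongr
      simpa [dist_eq_norm] using hz)) (by simp) (by simp)
  rw [add_sub_cancel_left] at h
  calc _ ≤ C * ‖w‖ * ‖w‖ := h
    _ = _ := by ring

theorem hasDerivAt_comp_add_smul {F : Type*} [NormedAddCommGroup F] [NormedSpace ℝ F] {φ : E → F}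
    (hφ : Differentiable ℝ φ) (x z : E) (s : ℝ) :
    HasDerivAt (fun s : ℝ => φ (x + s • z)) (fderiv ℝ φ (x + s • z) z) s := by
  have h1 : HasDerivAt (fun s : ℝ => x + s • z) z s := by
    simpa using ((hasDerivAt_id s).smul_const z).const_add x
  exact (hφ _).hasFDerivAt.comp_hasDerivAt s h1

theorem tendsto_taylor_two_along_line (hg : ContDiff ℝ 2 g) (x z : E) :
    Tendsto (fun s : ℝ => (g (x + s • z) - g x - s * fderiv ℝ g x z) / s ^ 2) (𝓝[>] 0)
      (𝓝 (fderiv ℝ (fderiv ℝ g) x z z / 2)) := by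
  have hd := hg.differentiable two_ne_zero
  have hd2 := (hg.fderiv_right (m := 1) (by norm_num)).differentiable one_ne_zero
  have h1 : ∀ s : ℝ, HasDerivAt (fun s : ℝ => g (x + s • z) - g x - s * fderiv ℝ g x z)
      (fderiv ℝ g (x + s • z) z - fderiv ℝ g x z) s := fun s => by
    simpa using ((hasDerivAt_comp_add_smul hd x z s).sub_const (g x)).fun_sub
      ((hasDerivAt_id' s).mul_const (fderiv ℝ g x z))
  have h2 : ∀ s : ℝ, HasDerivAt (fun s : ℝ => s ^ 2) (2 * s) s := fun s => by
    simpa using hasDerivAt_pow 2 s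
  refine HasDerivAt.lhopital_zero_nhdsGT (Eventually.of_forall h1) (Eventually.of_forall h2)
    ?_ ?_ ?_ ?_
  · filter_upwards [self_mem_nhdsWithin] with s hs
    exact mul_ne_zero two_ne_zero (ne_of_gt hs)
  · have := (h1 0).continuousAt.tendsto.mono_left (nhdsWithin_le_nhds (s := Set.Ioi 0))
    simpa using this
  · have := (h2 0).continuousAt.tendsto.mono_left (nhdsWithin_le_nhds (s := Set.Ioi 0))
    simpa using this
  · have h3 := (hasDerivAt_comp_add_smul hd2 x z 0).clm_apply (hasDerivAt_const 0 z)
    have h5 := h3.tendsto_slope_zero_right.div_const 2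
    simp only [zero_smul, add_zero, map_zero, zero_add, smul_eq_mul] at h5
    refine h5.congr' ?_
    filter_upwards [self_mem_nhdsWithin] with s hs
    have : s ≠ 0 := ne_of_gt hs
    field_simp

end Taylor

section Laplacian

variable {d : ℕ}

theorem laplacian_eq_sum_fderiv_fderiv (g : EuclideanSpace ℝ (Fin d) → ℝ)
    (x : EuclideanSpace ℝ (Fin d)) :
    laplacian g x = ∑ i, fderiv ℝ (fderiv ℝ g) x (EuclideanSpace.single i 1)
      (EuclideanSpace.single i 1) := by
  simp [laplacian, iteratedFDeriv_two_apply]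

theorem fderiv_fderiv_mul {E : Type*} [NormedAddCommGroup E] [NormedSpace ℝ E] {f h : E → ℝ}
    (hf : ContDiff ℝ 2 f) (hh : ContDiff ℝ 2 h) (x v : E) :
    fderiv ℝ (fderiv ℝ (fun y => f y * h y)) x v v =
      f x * fderiv ℝ (fderiv ℝ h) x v v + h x * fderiv ℝ (fderiv ℝ f) x v v +
        2 * (fderiv ℝ f x v * fderiv ℝ h x v) := by
  have hf1 := hf.differentiable two_ne_zero
  have hh1 := hh.differentiable two_ne_zero
  have hf2 := (hf.fderiv_right (m := 1) (by norm_num)).differentiable one_ne_zero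
  have hh2 := (hh.fderiv_right (m := 1) (by norm_num)).differentiable one_ne_zero
  have h1 : fderiv ℝ (fun y => f y * h y) =
      fun y => f y • fderiv ℝ h y + h y • fderiv ℝ f y := by
    ext1 y
    exact fderiv_fun_mul (hf1 y) (hh1 y)
  rw [h1, (((hf1 x).hasFDerivAt.fun_smul (hh2 x).hasFDerivAt).fun_add
    ((hh1 x).hasFDerivAt.fun_smul (hf2 x).hasFDerivAt)).fderiv]
  simp
  ring

theorem laplacian_mul {f h : EuclideanSpace ℝ (Fin d) → ℝ}
    (hf : ContDiff ℝ 2 f) (hh : ContDiff ℝ 2 h) (x : EuclideanSpace ℝ (Fin d)) :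
    laplacian (fun y => f y * h y) x = f x * laplacian h x + h x * laplacian f x +
      2 * ∑ i, fderiv ℝ f x (EuclideanSpace.single i 1) * fderiv ℝ h x (EuclideanSpace.single i 1)
      := by
  simp only [laplacian_eq_sum_fderiv_fderiv, fderiv_fderiv_mul hf hh, Finset.sum_add_distrib,
    Finset.mul_sum]

end Laplacian

section Expansion

variable {d : ℕ} {η : ℝ → EuclideanSpace ℝ (Fin d) → ℝ} {h₀ K C : ℝ}

theorem one_add_mul_exp_le (r : ℝ) :
    (1 + r) * Real.exp (r ^ 2 / 8) ≤ 4 * Real.exp (r ^ 2 / 4) := by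
  have h1 := Real.add_one_le_exp (r ^ 2 / 8)
  have h2 : Real.exp (r ^ 2 / 4) = Real.exp (r ^ 2 / 8) * Real.exp (r ^ 2 / 8) := by
    rw [← Real.exp_add]
    ring_nf
  rw [h2, ← mul_assoc]
  gcongr
  nlinarith [sq_nonneg (r - 1)]

theorem abs_le_of_abs_sub_le {s t r : ℝ} (hK : 0 ≤ K) (hs : s ≤ 1) (hr : 0 ≤ r)
    (h : |t - h₀| ≤ s * (K * ((1 + r) * Real.exp (r ^ 2 / 8)))) :
    |t| ≤ (|h₀| + K) * ((1 + r) * Real.exp (r ^ 2 / 8)) := by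
  have h1 : 1 ≤ (1 + r) * Real.exp (r ^ 2 / 8) :=
    one_le_mul_of_one_le_of_one_le (by linarith) (Real.one_le_exp (by positivity))
  have h2 : |t| ≤ |t - h₀| + |h₀| := by simpa using abs_add_le (t - h₀) h₀
  have h3 : s * (K * ((1 + r) * Real.exp (r ^ 2 / 8))) ≤
      1 * (K * ((1 + r) * Real.exp (r ^ 2 / 8))) := by gcongr
  nlinarith [abs_nonneg h₀]

theorem abs_le_mul_one_add_sq_mul_exp {t r A : ℝ} (hr : 0 ≤ r) (hA : 0 ≤ A)
    (h : |t| ≤ A * ((1 + r) * Real.exp (r ^ 2 / 8))) :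
    |t| ≤ 4 * A * ((1 + r) ^ 2 * Real.exp (r ^ 2 / 4)) := by
  have h1 := one_add_mul_exp_le r
  have h2 : 1 * Real.exp (r ^ 2 / 4) ≤ (1 + r) ^ 2 * Real.exp (r ^ 2 / 4) := by
    gcongr
    nlinarith
  calc |t| ≤ A * ((1 + r) * Real.exp (r ^ 2 / 8)) := h
    _ ≤ A * (4 * ((1 + r) ^ 2 * Real.exp (r ^ 2 / 4))) := by
      refine mul_le_mul_of_nonneg_left ?_ hA
      linarith
    _ = _ := by ring

theorem integrable_gaussDensity_mul_mul_of_abs_sub_le {s : ℝ}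
    {ζ φ : EuclideanSpace ℝ (Fin d) → ℝ} (hs : s ≤ 1) (hK : 0 ≤ K)
    (hmeas : AEStronglyMeasurable ζ)
    (hbound : ∀ z, |ζ z - h₀| ≤ s * (K * ((1 + ‖z‖) * Real.exp (‖z‖ ^ 2 / 8))))
    (hφ : AEStronglyMeasurable φ) (hφC : ∀ z, |φ z| ≤ C) :
    Integrable (fun z => gaussDensity z * (ζ z * φ z)) := by
  have hC : 0 ≤ C := (abs_nonneg _).trans (hφC 0)
  refine integrable_gaussDensity_mul (K := 4 * ((|h₀| + K) * C)) (hmeas.mul hφ) fun z => ?_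
  refine abs_le_mul_one_add_sq_mul_exp (norm_nonneg z) (by positivity) ?_
  rw [abs_mul]
  calc _ ≤ (|h₀| + K) * ((1 + ‖z‖) * Real.exp (‖z‖ ^ 2 / 8)) * C := by
        gcongr
        · exact abs_le_of_abs_sub_le hK hs (norm_nonneg z) (hbound z)
        · exact hφC z
    _ = _ := by ring

theorem tendsto_of_abs_sub_le {A : ℝ} {u : ℝ → ℝ}
    (h : ∀ᶠ s in 𝓝[>] (0 : ℝ), |u s - h₀| ≤ s * A) : Tendsto u (𝓝[>] 0) (𝓝 h₀) := by
  rw [tendsto_iff_norm_sub_tendsto_zero]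
  have h0 : Tendsto (fun s : ℝ => s * A) (𝓝[>] 0) (𝓝 0) := by
    have : Tendsto (fun s : ℝ => s * A) (𝓝 0) (𝓝 (0 * A)) := tendsto_id.mul_const A
    rw [zero_mul] at this
    exact this.mono_left nhdsWithin_le_nhds
  exact squeeze_zero' (Eventually.of_forall fun s => norm_nonneg _) h h0

theorem tendsto_integral_gaussDensity_mul_of_abs_sub_le (hK : 0 ≤ K)
    (hmeas : ∀ᶠ s in 𝓝[>] (0 : ℝ), AEStronglyMeasurable (η s))
    (hbound : ∀ᶠ s in 𝓝[>] (0 : ℝ), ∀ z,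
      |η s z - h₀| ≤ s * (K * ((1 + ‖z‖) * Real.exp (‖z‖ ^ 2 / 8)))) :
    Tendsto (fun s => ∫ z, gaussDensity z * η s z) (𝓝[>] 0) (𝓝 h₀) := by
  have h := tendsto_integral_gaussDensity_mul (l := 𝓝[>] 0) (F := η) (F0 := fun _ => h₀)
    (K := 4 * (|h₀| + K)) hmeas ?_ (fun z => tendsto_of_abs_sub_le (hbound.mono fun s hs => hs z))
  · rwa [integral_mul_const, integral_gaussDensity, one_mul] at h
  · filter_upwards [hbound, Ioc_mem_nhdsGT (zero_lt_one' ℝ)] with s hs hs1 z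
    exact abs_le_mul_one_add_sq_mul_exp (norm_nonneg z) (by positivity)
      (abs_le_of_abs_sub_le hK hs1.2 (norm_nonneg z) (hs z))

/-- Second-order expansion of a Gaussian average of a product `η s z * (g (x + s z) - g x)`, where
`η` has a first-order expansion in `s` and `g` has a bounded second derivative. -/
theorem tendsto_integral_gaussDensity_mul_sub
    {Λ : EuclideanSpace ℝ (Fin d) →L[ℝ] ℝ} {g : EuclideanSpace ℝ (Fin d) → ℝ}
    {x : EuclideanSpace ℝ (Fin d)} (hK : 0 ≤ K)
    (hmeas : ∀ᶠ s in 𝓝[>] (0 : ℝ), AEStronglyMeasurable (η s))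
    (hbound : ∀ᶠ s in 𝓝[>] (0 : ℝ), ∀ z,
      |η s z - h₀| ≤ s * (K * ((1 + ‖z‖) * Real.exp (‖z‖ ^ 2 / 8))))
    (hlim : ∀ z, Tendsto (fun s => (η s z - h₀) / s) (𝓝[>] 0) (𝓝 (Λ z)))
    (hg : ContDiff ℝ 2 g) (hC : ∀ y, ‖iteratedFDeriv ℝ 2 g y‖ ≤ C) :
    Tendsto (fun s => (∫ z, gaussDensity z * (η s z * (g (x + s • z) - g x))) / s ^ 2) (𝓝[>] 0)
      (𝓝 (h₀ * laplacian g x / 4 + (∑ i, Λ (EuclideanSpace.single i 1) *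
        fderiv ℝ g x (EuclideanSpace.single i 1)) / 2)) := by
  set Dg := fderiv ℝ g x with hDg
  have hC0 : 0 ≤ C := (norm_nonneg _).trans (hC x)
  let R : ℝ → EuclideanSpace ℝ (Fin d) → ℝ := fun s z => (g (x + s • z) - g x - s * Dg z) / s ^ 2
  let F : ℝ → EuclideanSpace ℝ (Fin d) → ℝ := fun s z => η s z * R s z + (η s z - h₀) / s * Dg z
  have hRbound : ∀ s > 0, ∀ z, |R s z| ≤ C * ‖z‖ ^ 2 := fun s hs z => by
    have h := norm_sub_fderiv_le_of_norm_iteratedFDeriv_two_le hg hC x (s • z)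
    rw [map_smul, smul_eq_mul, norm_smul, Real.norm_of_nonneg hs.le] at h
    rw [abs_div, abs_of_pos (pow_pos hs 2), div_le_iff₀ (by positivity)]
    exact h.trans (by ring_nf; rfl)
  have hFmeas : ∀ᶠ s in 𝓝[>] (0 : ℝ), AEStronglyMeasurable (F s) := by
    filter_upwards [hmeas] with s hs
    have hR : Continuous (R s) := by
      have := hg.continuous
      fun_prop
    simp only [F, div_eq_mul_inv (_ - h₀)]
    exact (hs.mul hR.aestronglyMeasurable).add
      (((hs.sub aestronglyMeasurable_const).mul_const s⁻¹).mul Dg.continuous.aestronglyMeasurable)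
  have hFbound : ∀ᶠ s in 𝓝[>] (0 : ℝ), ∀ z,
      |F s z| ≤ (4 * (|h₀| + K) * C + 4 * K * ‖Dg‖) *
        ((1 + ‖z‖) ^ 2 * Real.exp (‖z‖ ^ 2 / 4)) := by
    filter_upwards [hbound, Ioc_mem_nhdsGT (zero_lt_one' ℝ)] with s hs hs1 z
    have hz := norm_nonneg z
    have h1 := abs_le_of_abs_sub_le hK hs1.2 hz (hs z)
    have h2 := hRbound s hs1.1 z
    have h3 : |(η s z - h₀) / s| ≤ K * ((1 + ‖z‖) * Real.exp (‖z‖ ^ 2 / 8)) := by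
      rw [abs_div, abs_of_pos hs1.1, div_le_iff₀ hs1.1]
      linarith [hs z]
    have h4 : |Dg z| ≤ ‖Dg‖ * ‖z‖ := Dg.le_opNorm z
    have h5 := one_add_mul_exp_le ‖z‖
    calc |F s z| ≤ |η s z| * |R s z| + |(η s z - h₀) / s| * |Dg z| := by
          rw [← abs_mul, ← abs_mul]
          exact abs_add_le _ _
      _ ≤ ((|h₀| + K) * ((1 + ‖z‖) * Real.exp (‖z‖ ^ 2 / 8))) * (C * ‖z‖ ^ 2) +
          (K * ((1 + ‖z‖) * Real.exp (‖z‖ ^ 2 / 8))) * (‖Dg‖ * ‖z‖) := by gcongr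
      _ ≤ ((|h₀| + K) * (4 * Real.exp (‖z‖ ^ 2 / 4))) * (C * (1 + ‖z‖) ^ 2) +
          (K * (4 * Real.exp (‖z‖ ^ 2 / 4))) * (‖Dg‖ * (1 + ‖z‖) ^ 2) := by
        gcongr
        · linarith
        · nlinarith
      _ = _ := by ring
  have hFlim : ∀ z, Tendsto (fun s => F s z) (𝓝[>] 0)
      (𝓝 (h₀ * (fderiv ℝ (fderiv ℝ g) x z z / 2) + Λ z * Dg z)) := fun z =>
    ((tendsto_of_abs_sub_le (hbound.mono fun s hs => hs z)).mul
      (tendsto_taylor_two_along_line hg x z)).add ((hlim z).mul_const _)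
  have key := tendsto_integral_gaussDensity_mul hFmeas hFbound hFlim
  have hB := (integral_gaussDensity_mul_bilin
    ((h₀ / 2) • fderiv ℝ (fderiv ℝ g) x + Λ.smulRight Dg)).2
  have hval : ∫ z, gaussDensity z * (h₀ * (fderiv ℝ (fderiv ℝ g) x z z / 2) + Λ z * Dg z) =
      h₀ * laplacian g x / 4 + (∑ i, Λ (EuclideanSpace.single i 1) *
        Dg (EuclideanSpace.single i 1)) / 2 := by
    have h : ∀ z, h₀ * (fderiv ℝ (fderiv ℝ g) x z z / 2) + Λ z * Dg z =
        ((h₀ / 2) • fderiv ℝ (fderiv ℝ g) x + Λ.smulRight Dg) z z := fun z => by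
      simp
      ring
    simp only [h, hB, laplacian_eq_sum_fderiv_fderiv]
    simp [Finset.sum_add_distrib, ← Finset.mul_sum]
    ring
  rw [hval] at key
  refine key.congr' ?_
  filter_upwards [hFmeas, hFbound, self_mem_nhdsWithin] with s hs1 hs2 hs
  have hs0 : s ≠ 0 := ne_of_gt hs
  have h1 := integrable_gaussDensity_mul hs1 hs2
  have h2 := (integrable_gaussDensity_mul_clm Dg).const_mul (h₀ / s)
  rw [← integral_div]
  calc ∫ z, gaussDensity z * F s z
      = (∫ z, gaussDensity z * F s z) + ∫ z, h₀ / s * (gaussDensity z * Dg z) := by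
        rw [integral_const_mul, integral_gaussDensity_mul_clm, mul_zero, add_zero]
    _ = ∫ z, (gaussDensity z * F s z + h₀ / s * (gaussDensity z * Dg z)) :=
        (integral_add h1 h2).symm
    _ = _ := by
        congr 1
        ext z
        simp only [F, R]
        field_simp
        ring

end Expansion

section GaussAverage

variable {d : ℕ}

/-- The average of `q` over a Gaussian of scale `s` centred at `y`. -/
noncomputable def gaussAverage (q : EuclideanSpace ℝ (Fin d) → ℝ) (s : ℝ)
    (y : EuclideanSpace ℝ (Fin d)) : ℝ :=
  ∫ z, gaussDensity z * q (y + s • z)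

variable {q : EuclideanSpace ℝ (Fin d) → ℝ} {C : ℝ}

theorem gaussAverage_zero (y : EuclideanSpace ℝ (Fin d)) : gaussAverage q 0 y = q y := by
  simp [gaussAverage, integral_mul_const, integral_gaussDensity]

theorem integrable_gaussDensity_mul_comp (hq : Continuous q) (hC : ∀ y, |q y| ≤ C) (s : ℝ)
    (y : EuclideanSpace ℝ (Fin d)) : Integrable (fun z => gaussDensity z * q (y + s • z)) := by
  refine integrable_gaussDensity_mul (K := C) (by fun_prop) fun z => (hC _).trans ?_
  have hC0 : 0 ≤ C := (abs_nonneg _).trans (hC 0)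
  refine le_mul_of_one_le_right hC0 (le_trans ?_ (le_one_add_sq_mul_exp z))
  nlinarith [norm_nonneg z]

theorem continuous_gaussAverage (hq : Continuous q) (hC : ∀ y, |q y| ≤ C) (s : ℝ) :
    Continuous (gaussAverage q s) := by
  refine continuous_of_dominated (bound := fun z => gaussDensity z * C) (fun y => ?_) (fun y => ?_)
    (integrable_gaussDensity.mul_const C) ?_
  · exact (integrable_gaussDensity_mul_comp hq hC s y).aestronglyMeasurable
  · refine Eventually.of_forall fun z => ?_
    rw [norm_mul, Real.norm_of_nonneg (gaussDensity_pos z).le]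
    exact mul_le_mul_of_nonneg_left (hC _) (gaussDensity_pos z).le
  · exact Eventually.of_forall fun z => by fun_prop

theorem abs_gaussAverage_sub_le {B : ℝ} (hq : ContDiff ℝ 2 q) (hB : ∀ y, |q y| ≤ B)
    (hC : ∀ y, ‖iteratedFDeriv ℝ 2 q y‖ ≤ C) (s : ℝ) (y : EuclideanSpace ℝ (Fin d)) :
    |gaussAverage q s y - q y| ≤
      C * (∫ z : EuclideanSpace ℝ (Fin d), gaussMajorant z) * s ^ 2 := by
  have hC0 : 0 ≤ C := (norm_nonneg _).trans (hC y)
  have h1 := integrable_gaussDensity_mul_comp hq.continuous hB s y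
  have h2 : Integrable fun z : EuclideanSpace ℝ (Fin d) => gaussDensity z * q y :=
    integrable_gaussDensity.mul_const _
  have h3 := (integrable_gaussDensity_mul_clm (fderiv ℝ q y)).const_mul s
  have heq : gaussAverage q s y - q y =
      ∫ z, gaussDensity z * (q (y + s • z) - q y - fderiv ℝ q y (s • z)) := by
    calc gaussAverage q s y - q y
        = (∫ z, gaussDensity z * q (y + s • z)) -
            (∫ z : EuclideanSpace ℝ (Fin d), gaussDensity z * q y) -
            ∫ z, s * (gaussDensity z * fderiv ℝ q y z) := by
          rw [integral_const_mul, integral_gaussDensity_mul_clm, integral_mul_const,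
            integral_gaussDensity, gaussAverage]
          ring
      _ = _ := by
          have h12 : Integrable fun z => gaussDensity z * q (y + s • z) - gaussDensity z * q y :=
            h1.sub h2
          rw [← integral_sub h1 h2, ← integral_sub h12 h3]
          congr 1
          ext z
          simp
          ring
  rw [heq, ← Real.norm_eq_abs]
  have hle := norm_integral_le_of_norm_le (μ := volume)
    (f := fun z => gaussDensity z * (q (y + s • z) - q y - fderiv ℝ q y (s • z)))
    (integrable_gaussMajorant.const_mul (C * s ^ 2)) (Eventually.of_forall fun z =>
      gaussDensity_mul_norm_le (by
        refine (norm_sub_fderiv_le_of_norm_iteratedFDeriv_two_le hq hC y (s • z)).trans ?_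
        rw [norm_smul, mul_pow, Real.norm_eq_abs, sq_abs, ← mul_assoc]
        refine mul_le_mul_of_nonneg_left (le_trans ?_ (le_one_add_sq_mul_exp z)) (by positivity)
        nlinarith [norm_nonneg z]))
  rw [integral_const_mul] at hle
  linarith

theorem norm_add_sq_le_two_mul {E : Type*} [SeminormedAddCommGroup E] (a b : E) :
    ‖a + b‖ ^ 2 ≤ 2 * ‖a‖ ^ 2 + 2 * ‖b‖ ^ 2 := by
  have h1 : ‖a + b‖ ^ 2 ≤ (‖a‖ + ‖b‖) ^ 2 := by
    gcongr
    exact norm_add_le a b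
  nlinarith [sq_nonneg (‖a‖ - ‖b‖)]

theorem exists_forall_le_gaussAverage {B c : ℝ} (hq : Continuous q) (hB : ∀ y, |q y| ≤ B)
    (hC : 0 < C) (hc : 0 < c) (hlow : ∀ y, C * Real.exp (-c * ‖y‖ ^ 2) ≤ q y) :
    ∃ m > 0, ∀ s ∈ Set.Icc (0 : ℝ) 1, ∀ y,
      m * Real.exp (-(2 * c) * ‖y‖ ^ 2) ≤ gaussAverage q s y := by
  have hint : Integrable fun z : EuclideanSpace ℝ (Fin d) =>
      gaussDensity z * (C * Real.exp (-(2 * c) * ‖z‖ ^ 2)) := by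
    refine integrable_gaussDensity_mul (K := C)
      (Continuous.aestronglyMeasurable (by fun_prop)) fun z => ?_
    rw [abs_of_pos (by positivity)]
    refine mul_le_mul_of_nonneg_left (le_trans ?_ (le_one_add_sq_mul_exp z)) hC.le
    have : Real.exp (-(2 * c) * ‖z‖ ^ 2) ≤ 1 := Real.exp_le_one_iff.2 (by
      have : 0 ≤ (2 * c) * ‖z‖ ^ 2 := by positivity
      linarith)
    nlinarith [norm_nonneg z]
  refine ⟨∫ z : EuclideanSpace ℝ (Fin d), gaussDensity z * (C * Real.exp (-(2 * c) * ‖z‖ ^ 2)),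
    ?_, fun s hs y => ?_⟩
  · refine integral_pos_of_integrable_nonneg_nonzero (x := 0) (by fun_prop) hint
      (fun z => ?_) ?_
    · have := gaussDensity_pos z
      positivity
    · have := gaussDensity_pos (0 : EuclideanSpace ℝ (Fin d))
      positivity
  · rw [← integral_mul_const]
    refine integral_mono (hint.mul_const _) (integrable_gaussDensity_mul_comp hq hB s y)
      fun z => ?_
    have hγ := (gaussDensity_pos z).le
    refine le_trans ?_ (mul_le_mul_of_nonneg_left (hlow (y + s • z)) hγ)
    rw [mul_assoc, mul_assoc, ← Real.exp_add]
    gcongr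
    have h1 := norm_add_sq_le_two_mul y (s • z)
    rw [norm_smul, mul_pow, Real.norm_eq_abs, sq_abs] at h1
    have h2 : s ^ 2 * ‖z‖ ^ 2 ≤ 1 * ‖z‖ ^ 2 := by
      gcongr
      exact pow_le_one₀ hs.1 hs.2
    nlinarith

theorem abs_rpow_neg_sub_rpow_neg_le {α l u v : ℝ} (hα : α ∈ Set.Icc (0 : ℝ) 1) (hl : 0 < l)
    (hl1 : l ≤ 1) (hu : l ≤ u) (hv : l ≤ v) :
    |u ^ (-α) - v ^ (-α)| ≤ (l ^ 2)⁻¹ * |u - v| := by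
  refine (convex_Ici l).norm_image_sub_le_of_norm_deriv_le (𝕜 := ℝ) (f := fun t : ℝ => t ^ (-α))
    (fun t ht => ?_) (fun t ht => ?_) (Set.mem_Ici.2 hv) (Set.mem_Ici.2 hu)
  · exact (Real.hasDerivAt_rpow_const (Or.inl (hl.trans_le ht).ne')).differentiableAt
  · have ht0 : 0 < t := hl.trans_le ht
    rw [Real.deriv_rpow_const, norm_mul, norm_neg, Real.norm_of_nonneg hα.1,
      Real.norm_of_nonneg (by positivity)]
    calc α * t ^ (-α - 1) ≤ 1 * l ^ (-α - 1) := by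
          refine mul_le_mul hα.2 ?_ (by positivity) zero_le_one
          exact Real.rpow_le_rpow_of_nonpos hl ht (by linarith [hα.1])
      _ ≤ l ^ (-2 : ℝ) := by
          rw [one_mul]
          exact Real.rpow_le_rpow_of_exponent_ge hl hl1 (by linarith [hα.2])
      _ = (l ^ 2)⁻¹ := by
          rw [Real.rpow_neg hl.le]
          norm_num

theorem rpow_neg_le_inv_sq {α l u : ℝ} (hα : α ∈ Set.Icc (0 : ℝ) 1) (hl : 0 < l)
    (hl1 : l ≤ 1) (hu : l ≤ u) : u ^ (-α) ≤ (l ^ 2)⁻¹ :=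
  calc u ^ (-α) ≤ l ^ (-α) := Real.rpow_le_rpow_of_nonpos hl hu (by linarith [hα.1])
    _ ≤ l ^ (-2 : ℝ) := Real.rpow_le_rpow_of_exponent_ge hl hl1 (by linarith [hα.2])
    _ = (l ^ 2)⁻¹ := by
      rw [Real.rpow_neg hl.le]
      norm_num

theorem hasDerivAt_gaussAverage_along_line {B : ℝ} (hq : ContDiff ℝ 2 q) (hB : ∀ y, |q y| ≤ B)
    (hC : ∀ y, ‖iteratedFDeriv ℝ 2 q y‖ ≤ C) (x z : EuclideanSpace ℝ (Fin d)) :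
    HasDerivAt (fun s => gaussAverage q s (x + s • z)) (fderiv ℝ q x z) 0 := by
  have h1 := hasDerivAt_comp_add_smul (hq.differentiable two_ne_zero) x z 0
  have h2 : HasDerivAt (fun s => gaussAverage q s (x + s • z) - q (x + s • z)) 0 0 := by
    have hO : (fun s => gaussAverage q s (x + s • z) - q (x + s • z)) =O[𝓝 0]
        fun s : ℝ => ‖s - 0‖ ^ 2 := by
      refine Asymptotics.IsBigO.of_bound
        (C * ∫ z : EuclideanSpace ℝ (Fin d), gaussMajorant z) (Eventually.of_forall fun s => ?_)
      simpa using abs_gaussAverage_sub_le hq hB hC s (x + s • z)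
    exact (hO.hasFDerivAt (𝕜 := ℝ) one_lt_two).hasDerivAt
  have h3 := h1.fun_add h2
  simpa using h3

/-- First-order expansion of the normalized density `(gaussAverage q s)^(-α) * q` near `x`. -/
theorem tendsto_slope_gaussAverage_rpow_mul {B α : ℝ} (hq : ContDiff ℝ 2 q)
    (hB : ∀ y, |q y| ≤ B) (hC : ∀ y, ‖iteratedFDeriv ℝ 2 q y‖ ≤ C) (hpos : ∀ y, 0 < q y)
    (x z : EuclideanSpace ℝ (Fin d)) :
    Tendsto (fun s => (gaussAverage q s (x + s • z) ^ (-α) * q (x + s • z) - q x ^ (1 - α)) / s)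
      (𝓝[>] 0) (𝓝 (fderiv ℝ (fun y => q y ^ (1 - α)) x z)) := by
  have hx := hpos x
  have hd := hq.differentiable two_ne_zero
  have h1 := ((hasDerivAt_gaussAverage_along_line hq hB hC x z).rpow_const (p := -α)
    (Or.inl (by simpa [gaussAverage_zero] using hx.ne'))).fun_mul
    (hasDerivAt_comp_add_smul hd x z 0)
  have h2 := h1.tendsto_slope_zero_right
  have h3 : fderiv ℝ (fun y => q y ^ (1 - α)) x z = (1 - α) * q x ^ (-α) * fderiv ℝ q x z := by
    have h := (hd x).hasFDerivAt.rpow_const (p := 1 - α) (Or.inl hx.ne')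
    rw [h.fderiv]
    simp
  have h4 : q x ^ (-α - 1) * q x = q x ^ (-α) := by
    nth_rw 2 [← Real.rpow_one (q x)]
    rw [← Real.rpow_add hx]
    simp
  have h5 : q x ^ (-α) * q x = q x ^ (1 - α) := by
    nth_rw 2 [← Real.rpow_one (q x)]
    rw [← Real.rpow_add hx]
    ring_nf
  simp only [zero_add, zero_smul, add_zero, gaussAverage_zero, smul_eq_mul, h5] at h2
  rw [h3]
  convert h2 using 2
  · ring
  · linear_combination (α * fderiv ℝ q x z) * h4

theorem exists_abs_gaussAverage_rpow_mul_sub_le {α B C₁ C₂ c : ℝ} (hα : α ∈ Set.Icc (0 : ℝ) 1)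
    (hq : ContDiff ℝ 2 q) (hB : ∀ y, |q y| ≤ B)
    (hC₁ : ∀ y, ‖iteratedFDeriv ℝ 1 q y‖ ≤ C₁) (hC₂ : ∀ y, ‖iteratedFDeriv ℝ 2 q y‖ ≤ C₂)
    (hpos : ∀ y, 0 < q y)
    (hC : 0 < C) (hc : 0 < c) (hlow : ∀ y, C * Real.exp (-c * ‖y‖ ^ 2) ≤ q y)
    (x : EuclideanSpace ℝ (Fin d)) :
    ∃ K ≥ 0, ∀ᶠ s in 𝓝[>] (0 : ℝ), ∀ z,
      |gaussAverage q s (x + s • z) ^ (-α) * q (x + s • z) - q x ^ (1 - α)| ≤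
        s * (K * ((1 + ‖z‖) * Real.exp (‖z‖ ^ 2 / 8))) := by
  obtain ⟨m₀, hm₀, hav⟩ := exists_forall_le_gaussAverage hq.continuous hB hC hc hlow
  have hx := hpos x
  set M := ∫ z : EuclideanSpace ℝ (Fin d), gaussMajorant z
  have hM : 0 ≤ M := integral_nonneg fun z => by
    have := gaussDensity_pos z
    unfold gaussMajorant
    positivity
  have hC₁0 : 0 ≤ C₁ := (norm_nonneg _).trans (hC₁ x)
  have hC₂0 : 0 ≤ C₂ := (norm_nonneg _).trans (hC₂ x)
  set m := min (m₀ * Real.exp (-(4 * c) * ‖x‖ ^ 2)) (min 1 (q x)) with hm_def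
  have hm : 0 < m := by positivity
  refine ⟨(m ^ 2)⁻¹ * (C₁ + q x * (C₂ * M + C₁)), by positivity, ?_⟩
  have hδ : 0 < min 1 (1 / (64 * c)) := by positivity
  filter_upwards [Ioc_mem_nhdsGT hδ] with s hs z
  have hs0 : 0 < s := hs.1
  have hs1 : s ≤ 1 := hs.2.trans (min_le_left _ _)
  have hs2 : 64 * c * s ^ 2 ≤ 1 := by
    have h1 : s ≤ 1 / (64 * c) := hs.2.trans (min_le_right _ _)
    rw [le_div_iff₀ (by positivity)] at h1
    nlinarith
  set r := ‖z‖ with hr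
  have hr0 : 0 ≤ r := norm_nonneg z
  set l := m * Real.exp (-(4 * c * s ^ 2 * r ^ 2)) with hl_def
  have hl : 0 < l := by positivity
  have hlm : l ≤ m := mul_le_of_le_one_right hm.le (Real.exp_le_one_iff.2 (by
    have : 0 ≤ 4 * c * s ^ 2 * r ^ 2 := by positivity
    linarith))
  have hl1 : l ≤ 1 := hlm.trans ((min_le_right _ _).trans (min_le_left _ _))
  have hlv : l ≤ q x := hlm.trans ((min_le_right _ _).trans (min_le_right _ _))
  set u := gaussAverage q s (x + s • z) with hu_def
  set w := q (x + s • z) with hw_def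
  have hlu : l ≤ u := by
    refine le_trans ?_ (hav s ⟨hs0.le, hs1⟩ (x + s • z))
    calc l ≤ (m₀ * Real.exp (-(4 * c) * ‖x‖ ^ 2)) * Real.exp (-(4 * c * s ^ 2 * r ^ 2)) := by
          rw [hl_def]
          gcongr
          exact min_le_left _ _
      _ ≤ _ := by
          rw [mul_assoc, ← Real.exp_add]
          gcongr
          have h1 := norm_add_sq_le_two_mul x (s • z)
          rw [norm_smul, mul_pow, Real.norm_eq_abs, sq_abs] at h1
          nlinarith
  have hwx : |w - q x| ≤ C₁ * (s * r) := by
    have h := norm_sub_le_of_norm_iteratedFDeriv_one_le (hq.of_le one_le_two) hC₁ x (x + s • z)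
    rwa [add_sub_cancel_left, norm_smul, Real.norm_of_nonneg hs0.le] at h
  have huw : |u - w| ≤ C₂ * M * s := by
    refine (abs_gaussAverage_sub_le hq hB hC₂ s (x + s • z)).trans ?_
    gcongr
    nlinarith
  have hux : |u - q x| ≤ C₂ * M * s + C₁ * (s * r) :=
    (abs_sub_le u w (q x)).trans (add_le_add huw hwx)
  have h5 : q x ^ (1 - α) = q x ^ (-α) * q x := by
    nth_rw 3 [← Real.rpow_one (q x)]
    rw [← Real.rpow_add hx]
    ring_nf
  have hl2 : (l ^ 2)⁻¹ ≤ (m ^ 2)⁻¹ * Real.exp (r ^ 2 / 8) := by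
    rw [hl_def, mul_pow, mul_inv, ← Real.exp_nat_mul, ← Real.exp_neg]
    gcongr
    push_cast
    nlinarith [sq_nonneg r]
  have hupos : 0 ≤ u ^ (-α) := Real.rpow_nonneg (hl.trans_le hlu).le _
  calc |u ^ (-α) * w - q x ^ (1 - α)|
      = |u ^ (-α) * (w - q x) + (u ^ (-α) - q x ^ (-α)) * q x| := by
        rw [h5]
        ring_nf
    _ ≤ u ^ (-α) * |w - q x| + |u ^ (-α) - q x ^ (-α)| * q x := by
        refine (abs_add_le _ _).trans ?_
        rw [abs_mul, abs_mul, abs_of_nonneg hupos, abs_of_pos hx]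
    _ ≤ (l ^ 2)⁻¹ * (C₁ * (s * r)) + (l ^ 2)⁻¹ * (C₂ * M * s + C₁ * (s * r)) * q x := by
        gcongr
        · exact rpow_neg_le_inv_sq hα hl hl1 hlu
        · exact (abs_rpow_neg_sub_rpow_neg_le hα hl hl1 hlu hlv).trans (by gcongr)
    _ = (l ^ 2)⁻¹ * (s * (C₁ * r + q x * (C₂ * M + C₁ * r))) := by ring
    _ ≤ ((m ^ 2)⁻¹ * Real.exp (r ^ 2 / 8)) *
          (s * (C₁ * (1 + r) + q x * (C₂ * M * (1 + r) + C₁ * (1 + r)))) := by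
        have e1 : C₁ * r ≤ C₁ * (1 + r) := by nlinarith
        have e2 : C₂ * M ≤ C₂ * M * (1 + r) :=
          le_mul_of_one_le_right (by positivity) (by linarith)
        exact mul_le_mul hl2 (mul_le_mul_of_nonneg_left (add_le_add e1
          (mul_le_mul_of_nonneg_left (add_le_add e2 e1) hx.le)) hs0.le)
          (by positivity) (by positivity)
    _ = _ := by ring

end GaussAverage

/-- Diffusion maps pointwise generator for normalization parameter `α ∈ [0,1]`
(flat Euclidean version): `ε⁻¹ (P_{ε,α} f(x) − f(x)) →
Δ(f q^{1−α})(x)/(4 q^{1−α}(x)) − (Δ(q^{1−α})(x)/(4 q^{1−α}(x))) f(x)` as `ε → 0⁺`. -/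
theorem diffusion_maps_generator_alpha
    {d : ℕ} (α : ℝ) (hα : α ∈ Set.Icc (0 : ℝ) 1)
    (q : EuclideanSpace ℝ (Fin d) → ℝ)
    (hqsmooth : ContDiff ℝ (⊤ : ℕ∞) q) (hqpos : ∀ x, 0 < q x) (hqint : ∫ x, q x = 1)
    (hqderivbdd : ∀ n : ℕ, ∃ C : ℝ, ∀ x, ‖iteratedFDeriv ℝ n q x‖ ≤ C)
    (hqlower : ∃ C c : ℝ, 0 < C ∧ 0 < c ∧
      ∀ y, C * Real.exp (-c * ‖y‖ ^ 2) ≤ q y)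
    (f : EuclideanSpace ℝ (Fin d) → ℝ)
    (hf : ContDiff ℝ (⊤ : ℕ∞) f) (hfsupp : HasCompactSupport f)
    (kε : ℝ → EuclideanSpace ℝ (Fin d) → EuclideanSpace ℝ (Fin d) → ℝ)
    (hkε : ∀ ε x y, kε ε x y = Real.pi ^ (-(d : ℝ) / 2) * Real.exp (-‖x - y‖ ^ 2 / ε))
    (Dε : ℝ → (EuclideanSpace ℝ (Fin d) → ℝ) → EuclideanSpace ℝ (Fin d) → ℝ)
    (hDε : ∀ ε g x, Dε ε g x = ε ^ (-(d : ℝ) / 2) * ∫ y, kε ε x y * g y)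
    (qε : ℝ → EuclideanSpace ℝ (Fin d) → ℝ)
    (hqε : ∀ ε x, qε ε x = Dε ε q x)
    (P : ℝ → (EuclideanSpace ℝ (Fin d) → ℝ) → EuclideanSpace ℝ (Fin d) → ℝ)
    (hP : ∀ ε g x, P ε g x =
      (∫ y, kε ε x y * qε ε y ^ (-α) * g y * q y) /
      (∫ y, kε ε x y * qε ε y ^ (-α) * q y))
    (x : EuclideanSpace ℝ (Fin d)) :
    Tendsto (fun ε : ℝ => ε⁻¹ * (P ε f x - f x)) (𝓝[>] (0 : ℝ))
      (𝓝 (laplacian (fun y => f y * q y ^ ((1 : ℝ) - α)) x / (4 * q x ^ ((1 : ℝ) - α))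
        - laplacian (fun y => q y ^ ((1 : ℝ) - α)) x / (4 * q x ^ ((1 : ℝ) - α)) * f x)) := by
  obtain ⟨B, hB⟩ := hqderivbdd 0
  obtain ⟨C₁, hC₁⟩ := hqderivbdd 1
  obtain ⟨C₂, hC₂⟩ := hqderivbdd 2
  obtain ⟨C, c, hC, hc, hlow⟩ := hqlower
  have hB' : ∀ y, |q y| ≤ B := fun y => by simpa using hB y
  have hq2 : ContDiff ℝ 2 q := contDiff_infty.1 hqsmooth 2
  have hf2 : ContDiff ℝ 2 f := contDiff_infty.1 hf 2
  obtain ⟨Cf, hCf⟩ := (hfsupp.iteratedFDeriv 2).exists_bound_of_continuous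
    (hf2.continuous_iteratedFDeriv (m := 2) le_rfl)
  obtain ⟨Bf, hBf⟩ := hfsupp.exists_bound_of_continuous hf.continuous
  let h : EuclideanSpace ℝ (Fin d) → ℝ := fun y => q y ^ (1 - α)
  have hh2 : ContDiff ℝ 2 h := hq2.rpow_const_of_ne fun y => (hqpos y).ne'
  have hhx : 0 < h x := Real.rpow_pos_of_pos (hqpos x) _
  let η : ℝ → EuclideanSpace ℝ (Fin d) → ℝ := fun s z =>
    gaussAverage q s (x + s • z) ^ (-α) * q (x + s • z)
  have hmeas : ∀ s, AEStronglyMeasurable (η s) := fun s => by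
    have h1 := (continuous_gaussAverage hq2.continuous hB' s).measurable
    have h2 := hq2.continuous.measurable
    exact Measurable.aestronglyMeasurable (by fun_prop)
  obtain ⟨K, hK, hbound⟩ : ∃ K ≥ 0, ∀ᶠ s in 𝓝[>] (0 : ℝ), ∀ z,
      |η s z - h x| ≤ s * (K * ((1 + ‖z‖) * Real.exp (‖z‖ ^ 2 / 8))) :=
    exists_abs_gaussAverage_rpow_mul_sub_le hα hq2 hB' hC₁ hC₂ hqpos hC hc hlow x
  have hlim : ∀ z, Tendsto (fun s => (η s z - h x) / s) (𝓝[>] 0) (𝓝 (fderiv ℝ h x z)) :=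
    fun z => tendsto_slope_gaussAverage_rpow_mul hq2 hB' hC₂ hqpos x z
  have hden := tendsto_integral_gaussDensity_mul_of_abs_sub_le (η := η) (h₀ := h x) hK
    (Eventually.of_forall hmeas) hbound
  have hnum := tendsto_integral_gaussDensity_mul_sub (η := η) (h₀ := h x) (x := x) hK
    (Eventually.of_forall hmeas) hbound hlim hf2 hCf
  have hquot := hnum.div hden hhx.ne'
  have hqε_sq : ∀ s > 0, ∀ y, qε (s ^ 2) y = gaussAverage q s y := fun s hs y => by
    simp only [hqε, hDε, hkε]
    rw [integral_exp_neg_norm_sub_sq_div hs, ← mul_assoc, gaussAverage, ← Real.rpow_natCast s 2,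
      ← Real.rpow_mul hs.le, ← Real.rpow_natCast s d, ← Real.rpow_add hs]
    have : ((2 : ℕ) : ℝ) * (-(d : ℝ) / 2) + d = 0 := by
      push_cast
      ring
    rw [this, Real.rpow_zero, one_mul]
  have hlimit : laplacian (fun y => f y * h y) x / (4 * h x) - laplacian h x / (4 * h x) * f x =
      (h x * laplacian f x / 4 + (∑ i, fderiv ℝ h x (EuclideanSpace.single i 1) *
        fderiv ℝ f x (EuclideanSpace.single i 1)) / 2) / h x := by
    rw [laplacian_mul hf2 hh2]
    simp only [mul_comm (fderiv ℝ f x _)]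
    field_simp
    ring
  change Tendsto _ _ (𝓝 (laplacian (fun y => f y * h y) x / (4 * h x) -
    laplacian h x / (4 * h x) * f x))
  rw [hlimit]
  have hsqrt : Tendsto Real.sqrt (𝓝[>] 0) (𝓝[>] 0) := by
    refine tendsto_nhdsWithin_iff.2 ⟨?_, ?_⟩
    · have := (Real.continuous_sqrt.tendsto 0).mono_left (nhdsWithin_le_nhds (s := Set.Ioi 0))
      simpa using this
    · filter_upwards [self_mem_nhdsWithin] with ε hε
      exact Real.sqrt_pos.2 hε
  have hmain : Tendsto (fun s : ℝ => (s ^ 2)⁻¹ * (P (s ^ 2) f x - f x)) (𝓝[>] 0)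
      (𝓝 ((h x * laplacian f x / 4 + (∑ i, fderiv ℝ h x (EuclideanSpace.single i 1) *
        fderiv ℝ f x (EuclideanSpace.single i 1)) / 2) / h x)) := by
    refine hquot.congr' ?_
    filter_upwards [hbound, Ioc_mem_nhdsGT (zero_lt_one' ℝ), hden.eventually_ne hhx.ne']
      with s hs hs1 hne
    have hs0 : s ≠ 0 := hs1.1.ne'
    have hint := integrable_gaussDensity_mul_mul_of_abs_sub_le hs1.2 hK (hmeas s) hs
      (φ := fun z => f (x + s • z)) (C := Bf)
      (Continuous.aestronglyMeasurable (by have := hf.continuous; fun_prop))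
      (fun z => by simpa using hBf (x + s • z))
    have hint1 := integrable_gaussDensity_mul_mul_of_abs_sub_le hs1.2 hK (hmeas s) hs
      (φ := fun _ => f x) (C := |f x|) aestronglyMeasurable_const (fun _ => le_rfl)
    have hN : ∫ y, kε (s ^ 2) x y * qε (s ^ 2) y ^ (-α) * f y * q y =
        s ^ d * ∫ z, gaussDensity z * (η s z * f (x + s • z)) := by
      have e := integral_exp_neg_norm_sub_sq_div hs1.1 x
        (fun y => gaussAverage q s y ^ (-α) * q y * f y)
      rw [← e]
      congr 1
      ext y
      rw [hkε, hqε_sq s hs1.1]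
      ring
    have hD : ∫ y, kε (s ^ 2) x y * qε (s ^ 2) y ^ (-α) * q y =
        s ^ d * ∫ z, gaussDensity z * η s z := by
      have e := integral_exp_neg_norm_sub_sq_div hs1.1 x
        (fun y => gaussAverage q s y ^ (-α) * q y)
      rw [← e]
      congr 1
      ext y
      rw [hkε, hqε_sq s hs1.1]
      ring
    have hsub : ∫ z, gaussDensity z * (η s z * (f (x + s • z) - f x)) =
        (∫ z, gaussDensity z * (η s z * f (x + s • z))) -
          (∫ z, gaussDensity z * η s z) * f x := by
      rw [← integral_mul_const]
      simp only [mul_sub, mul_assoc]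
      exact integral_sub hint hint1
    rw [hP, hN, hD, mul_div_mul_left _ _ (pow_ne_zero d hs0)]
    change (∫ z, gaussDensity z * (η s z * (f (x + s • z) - f x))) / s ^ 2 /
      (∫ z, gaussDensity z * η s z) = _
    change (∫ z, gaussDensity z * η s z) ≠ 0 at hne
    rw [hsub]
    field_simp
  refine (hmain.comp hsqrt).congr' ?_
  filter_upwards [self_mem_nhdsWithin] with ε hε
  simp only [Function.comp_apply, Real.sq_sqrt (le_of_lt hε)]
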